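/- Let 0 < α < β < 1. The system (S, ν) is mixing: for all Borel sets A, B ⊆ I × I, ν(S^{-n}A ∩ B) → ν(A)ν(B) as n → ∞. -/

import Mathlib

open MeasureTheory Filter Set Topology

noncomputable section

/-- The Liverani–Saussol–Vaienti map `T_a` on `[0,1]`. -/
def lsv (a x : ℝ) : ℝ := if x ≤ 1 / 2 then x * (1 + (2 : ℝ) ^ a * x ^ a) else 2 * x - 1

/-- Random parameter selection: `α` on `[0,p₁)`, `β` on `[p₁,1]`. -/
def alphaOf (α β p₁ ω : ℝ) : ℝ := if ω < p₁ then α else β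

/-- The noise dynamics `φ` on `[0,1]`. -/
def phiMap (p₁ ω : ℝ) : ℝ := if ω < p₁ then ω / p₁ else (ω - p₁) / (1 - p₁)

/-- The skew product `S(x,ω) = (T_{α(ω)} x, φ ω)`. -/
def skewLSV (α β p₁ : ℝ) (p : ℝ × ℝ) : ℝ × ℝ :=
  (lsv (alphaOf α β p₁ p.2) p.1, phiMap p₁ p.2)

/-- The base of inducing, `Δ₀ = (1/2,1] × [0,1]`. -/
def Δ0 : Set (ℝ × ℝ) := Ioc (1 / 2 : ℝ) 1 ×ˢ Icc (0 : ℝ) 1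

/-- Change of variables for the image of a weighted Lebesgue measure under an injective map. -/
lemma map_withDensity_restrict {f f' k : ℝ → ℝ} {s t : Set ℝ} (w : ℝ → ENNReal)
    (hs : MeasurableSet s) (hf : Measurable f)
    (hf' : ∀ x ∈ s, HasDerivWithinAt f (f' x) s x) (hpos : ∀ x ∈ s, 0 < f' x)
    (himg : f '' s = t) (hk : ∀ x ∈ s, k (f x) = x) :
    ((volume.restrict s).withDensity w).map f =
      (volume.restrict t).withDensity (fun y => w (k y) / ENNReal.ofReal (f' (k y))) := by
  have hinj : InjOn f s := fun x hx y hy h => by rw [← hk x hx, h, hk y hy]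
  ext A hA
  have hset : A ∩ t = f '' (f ⁻¹' A ∩ s) := by
    rw [← himg, inter_comm, image_preimage_inter, inter_comm]
  rw [Measure.map_apply hf hA, withDensity_apply _ (hf hA), withDensity_apply _ hA,
    Measure.restrict_restrict (hf hA), Measure.restrict_restrict hA, hset,
    lintegral_image_eq_lintegral_abs_deriv_mul ((hf hA).inter hs)
      (fun x hx => (hf' x hx.2).mono inter_subset_right) (hinj.mono inter_subset_right)]
  refine setLIntegral_congr_fun ((hf hA).inter hs) fun x hx => ?_
  have hx' := hpos x hx.2
  simp only [hk x hx.2, abs_of_pos hx']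
  rw [ENNReal.mul_div_cancel (by simpa using hx') ENNReal.ofReal_ne_top]

/-- Nonnegative decreasing functions on `(0,1]` that become increasing after multiplication
by `x ^ 2`. -/
structure InCone (g : ℝ → ℝ) : Prop where
  nonneg : ∀ x ∈ Ioc (0 : ℝ) 1, 0 ≤ g x
  anti : AntitoneOn g (Ioc 0 1)
  mono : MonotoneOn (fun x => x ^ 2 * g x) (Ioc 0 1)

namespace InCone

lemma add {g h : ℝ → ℝ} (hg : InCone g) (hh : InCone h) : InCone (fun x => g x + h x) where
  nonneg x hx := add_nonneg (hg.nonneg x hx) (hh.nonneg x hx)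
  anti := hg.anti.add hh.anti
  mono := by simpa only [mul_add] using hg.mono.add hh.mono

lemma const_mul {g : ℝ → ℝ} (hg : InCone g) {c : ℝ} (hc : 0 ≤ c) :
    InCone (fun x => c * g x) where
  nonneg x hx := mul_nonneg hc (hg.nonneg x hx)
  anti x hx y hy h := mul_le_mul_of_nonneg_left (hg.anti hx hy h) hc
  mono x hx y hy h := by
    have := mul_le_mul_of_nonneg_left (hg.mono hx hy h) hc
    simp only at this ⊢
    linarith

lemma one : InCone (fun _ => 1) where
  nonneg _ _ := zero_le_one
  anti _ _ _ _ _ := le_rfl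
  mono x hx y _ h := by
    simp only [mul_one]
    exact pow_le_pow_left₀ hx.1.le h 2

end InCone

/-- The measure on `(0,1]` with density `g`. -/
def densMeasure (g : ℝ → ℝ) : Measure ℝ :=
  (volume.restrict (Ioc 0 1)).withDensity (fun x => ENNReal.ofReal (g x))

instance (g : ℝ → ℝ) : SFinite (densMeasure g) := by unfold densMeasure; infer_instance

lemma InCone.aemeasurable {g : ℝ → ℝ} (hg : InCone g) :
    AEMeasurable (fun x => ENNReal.ofReal (g x)) (volume.restrict (Ioc 0 1)) :=
  (aemeasurable_restrict_of_antitoneOn measurableSet_Ioc hg.anti).ennreal_ofReal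

lemma densMeasure_add {g h : ℝ → ℝ} (hg : InCone g) (hh : InCone h) :
    densMeasure (fun x => g x + h x) = densMeasure g + densMeasure h := by
  ext A hA
  simp only [densMeasure, Measure.add_apply, withDensity_apply _ hA]
  rw [← lintegral_add_left' hg.aemeasurable.restrict,
    Measure.restrict_restrict hA]
  exact setLIntegral_congr_fun (hA.inter measurableSet_Ioc) fun x hx =>
    ENNReal.ofReal_add (hg.nonneg x hx.2) (hh.nonneg x hx.2)

lemma densMeasure_const_mul {g : ℝ → ℝ} {c : ℝ} (hc : 0 ≤ c) :
    densMeasure (fun x => c * g x) = ENNReal.ofReal c • densMeasure g := by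
  simp only [densMeasure, ENNReal.ofReal_mul hc]
  exact withDensity_smul' _ _ ENNReal.ofReal_ne_top

lemma lsv_left {a x : ℝ} (hx : x ≤ 1 / 2) : lsv a x = x * (1 + (2 : ℝ) ^ a * x ^ a) :=
  if_pos hx

lemma lsv_right {a x : ℝ} (hx : 1 / 2 < x) : lsv a x = 2 * x - 1 :=
  if_neg (not_le.2 hx)

lemma measurable_lsv (a : ℝ) : Measurable (lsv a) := by
  unfold lsv
  refine Measurable.ite measurableSet_Iic ?_ ?_ <;> fun_prop

/-- The derivative of the left branch. -/
def lsvDeriv (a x : ℝ) : ℝ := 1 + (1 + a) * (2 ^ a * x ^ a)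

lemma hasDerivWithinAt_lsv {a x : ℝ} (hx : x ∈ Ioc (0 : ℝ) (1 / 2)) :
    HasDerivWithinAt (lsv a) (lsvDeriv a x) (Ioc 0 (1 / 2)) x := by
  have h := ((hasDerivAt_id x).mul (((Real.hasDerivAt_rpow_const (p := a)
    (Or.inl hx.1.ne')).const_mul ((2 : ℝ) ^ a)).const_add 1)).hasDerivWithinAt
      (s := Ioc 0 (1 / 2))
  refine (h.congr (fun y hy => lsv_left hy.2) (lsv_left hx.2)).congr_deriv ?_
  have : x ^ a = x * x ^ (a - 1) := by
    rw [Real.rpow_sub_one hx.1.ne']; field_simp [hx.1.ne']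
  simp only [lsvDeriv, id]
  rw [this]
  ring

lemma two_rpow_mul_mono {a x y : ℝ} (ha : 0 < a) (hx : 0 ≤ x) (h : x ≤ y) :
    (2 : ℝ) ^ a * x ^ a ≤ 2 ^ a * y ^ a :=
  mul_le_mul_of_nonneg_left (Real.rpow_le_rpow hx h ha.le) (by positivity)

lemma strictMonoOn_lsv {a : ℝ} (ha : 0 < a) : StrictMonoOn (lsv a) (Ioc 0 (1 / 2)) := by
  intro x hx y hy h
  rw [lsv_left hx.2, lsv_left hy.2]
  have := two_rpow_mul_mono ha hx.1.le h.le
  have h0 : 0 ≤ (2 : ℝ) ^ a * x ^ a := by have := hx.1; positivity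
  nlinarith [hx.1]

lemma lsv_half {a : ℝ} : lsv a (1 / 2) = 1 := by
  rw [lsv_left le_rfl, ← Real.mul_rpow (by norm_num) (by norm_num)]
  norm_num

lemma image_lsv {a : ℝ} (ha : 0 < a) : lsv a '' Ioc 0 (1 / 2) = Ioc 0 1 := by
  apply Subset.antisymm
  · rintro _ ⟨x, hx, rfl⟩
    constructor
    · rw [lsv_left hx.2]
      have := hx.1
      positivity
    · rw [← lsv_half (a := a)]
      exact (strictMonoOn_lsv ha).monotoneOn hx (by norm_num) hx.2
  · intro y hy
    have hc : ContinuousOn (lsv a) (Icc 0 (1 / 2)) := by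
      have : ContinuousOn (fun x : ℝ => x * (1 + (2 : ℝ) ^ a * x ^ a)) (Icc 0 (1 / 2)) := by
        refine continuousOn_id.mul (continuousOn_const.add (continuousOn_const.mul ?_))
        exact (Real.continuous_rpow_const ha.le).continuousOn
      exact this.congr fun x hx => lsv_left hx.2
    have h0 : lsv a 0 = 0 := by rw [lsv_left (by norm_num)]; simp
    obtain ⟨x, hx, rfl⟩ := intermediate_value_Icc (by norm_num) hc
      (show y ∈ Icc (lsv a 0) (lsv a (1 / 2)) by rw [h0, lsv_half]; exact ⟨hy.1.le, hy.2⟩)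
    refine ⟨x, ⟨lt_of_le_of_ne hx.1 fun h => ?_, hx.2⟩, rfl⟩
    rw [← h, h0] at hy
    exact lt_irrefl _ hy.1

lemma lsv_sq_div_mono {a c d : ℝ} (ha1 : a ≤ 1) (ha : 0 < a) (hc : 0 ≤ c) (h : c ≤ d) :
    (1 + c) ^ 2 / (1 + (1 + a) * c) ≤ (1 + d) ^ 2 / (1 + (1 + a) * d) := by
  rw [div_le_div_iff₀ (by positivity) (by have := hc.trans h; positivity)]
  have hd := hc.trans h
  have : 0 ≤ (d - c) * ((1 - a) + (d + c) + (1 + a) * (c * d)) := by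
    apply mul_nonneg (by linarith)
    have : 0 ≤ (1 + a) * (c * d) := by positivity
    linarith
  nlinarith

/-- Transfer through the left branch preserves the cone. -/
lemma exists_map_left {a : ℝ} (ha : 0 < a) (ha1 : a ≤ 1) {g : ℝ → ℝ} (hg : InCone g) :
    ∃ h, InCone h ∧ ((densMeasure g).restrict (Iic (1 / 2))).map (lsv a) = densMeasure h := by
  set k := Function.invFunOn (lsv a) (Ioc 0 (1 / 2)) with hk
  have hkmem : ∀ y ∈ Ioc (0 : ℝ) 1, k y ∈ Ioc (0 : ℝ) (1 / 2) ∧ lsv a (k y) = y := by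
    intro y hy
    rw [← image_lsv ha] at hy
    exact ⟨Function.invFunOn_mem hy, Function.invFunOn_eq hy⟩
  have hkl : ∀ x ∈ Ioc (0 : ℝ) (1 / 2), k (lsv a x) = x := fun x hx =>
    (strictMonoOn_lsv ha).injOn.leftInvOn_invFunOn hx
  have hkmono : MonotoneOn k (Ioc 0 1) := by
    intro y hy z hz h
    obtain ⟨h1, h2⟩ := hkmem y hy
    obtain ⟨h3, h4⟩ := hkmem z hz
    rwa [← (strictMonoOn_lsv ha).le_iff_le h1 h3, h2, h4]
  have hin : ∀ y ∈ Ioc (0 : ℝ) 1, k y ∈ Ioc (0 : ℝ) 1 := fun y hy =>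
    ⟨(hkmem y hy).1.1, (hkmem y hy).1.2.trans (by norm_num)⟩
  have hpos : ∀ x : ℝ, 0 < x → 0 < lsvDeriv a x := fun x hx => by
    unfold lsvDeriv; positivity
  refine ⟨fun y => g (k y) / lsvDeriv a (k y), ⟨?_, ?_, ?_⟩, ?_⟩
  · exact fun y hy => div_nonneg (hg.nonneg _ (hin y hy)) (hpos _ (hin y hy).1).le
  · intro y hy z hz h
    have hm := hkmono hy hz h
    refine div_le_div₀ (hg.nonneg _ (hin y hy)) (hg.anti (hin y hy) (hin z hz) hm)
      (hpos _ (hin y hy).1) ?_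
    have := two_rpow_mul_mono ha (hin y hy).1.le hm
    unfold lsvDeriv
    nlinarith
  · have key : ∀ y ∈ Ioc (0 : ℝ) 1, y ^ 2 * (g (k y) / lsvDeriv a (k y)) =
        (k y ^ 2 * g (k y)) * ((1 + 2 ^ a * k y ^ a) ^ 2 / lsvDeriv a (k y)) := by
      intro y hy
      have h1 := (hkmem y hy).2
      rw [lsv_left (hkmem y hy).1.2] at h1
      have h2 : y ^ 2 = (k y * (1 + 2 ^ a * k y ^ a)) ^ 2 := by rw [h1]
      rw [h2]
      ring
    intro y hy z hz h
    have hm := hkmono hy hz h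
    simp only [key y hy, key z hz]
    have h0 : 0 ≤ (2 : ℝ) ^ a * k y ^ a := by have := (hin y hy).1; positivity
    refine mul_le_mul (hg.mono (hin y hy) (hin z hz) hm)
      (lsv_sq_div_mono ha1 ha h0 (two_rpow_mul_mono ha (hin y hy).1.le hm)) ?_ ?_
    · have := hpos _ (hin y hy).1
      positivity
    · exact mul_nonneg (sq_nonneg _) (hg.nonneg _ (hin z hz))
  · have hset : Iic (1 / 2 : ℝ) ∩ Ioc 0 1 = Ioc 0 (1 / 2) := by
      ext x; simp only [mem_inter_iff, mem_Iic, mem_Ioc]; constructor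
      · rintro ⟨h1, h2, h3⟩; exact ⟨h2, h1⟩
      · rintro ⟨h1, h2⟩; exact ⟨h2, h1, by linarith⟩
    rw [densMeasure, restrict_withDensity measurableSet_Iic,
      Measure.restrict_restrict measurableSet_Iic, hset,
      map_withDensity_restrict (k := k) _ measurableSet_Ioc (measurable_lsv a)
        (fun x hx => hasDerivWithinAt_lsv hx) (fun x hx => hpos x hx.1) (image_lsv ha) hkl]
    refine withDensity_congr_ae ((ae_restrict_iff' measurableSet_Ioc).2
      (ae_of_all _ fun y hy => ?_))
    simp only
    rw [ENNReal.ofReal_div_of_pos (hpos _ (hin y hy).1)]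

/-- Transfer through the right branch preserves the cone. -/
lemma exists_map_right (a : ℝ) {g : ℝ → ℝ} (hg : InCone g) :
    ∃ h, InCone h ∧ ((densMeasure g).restrict (Ioi (1 / 2))).map (lsv a) = densMeasure h := by
  have hin : ∀ y ∈ Ioc (0 : ℝ) 1, (y + 1) / 2 ∈ Ioc (0 : ℝ) 1 := fun y hy =>
    ⟨by linarith [hy.1], by linarith [hy.2]⟩
  refine ⟨fun y => g ((y + 1) / 2) / 2, ⟨?_, ?_, ?_⟩, ?_⟩
  · exact fun y hy => div_nonneg (hg.nonneg _ (hin y hy)) zero_le_two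
  · intro y hy z hz h
    exact div_le_div_of_nonneg_right
      (hg.anti (hin y hy) (hin z hz) (by linarith)) zero_le_two
  · have key : ∀ y ∈ Ioc (0 : ℝ) 1, y ^ 2 * (g ((y + 1) / 2) / 2) =
        (((y + 1) / 2) ^ 2 * g ((y + 1) / 2)) * (2 * (y / (y + 1)) ^ 2) := by
      intro y hy
      have : y + 1 ≠ 0 := by linarith [hy.1]
      field_simp
    intro y hy z hz h
    have hy0 := hy.1
    have hz0 := hz.1
    simp only [key y hy, key z hz]
    refine mul_le_mul (hg.mono (hin y hy) (hin z hz) (by linarith)) ?_ (by positivity) ?_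
    · have : y / (y + 1) ≤ z / (z + 1) := by
        rw [div_le_div_iff₀ (by linarith) (by linarith)]; nlinarith
      have := pow_le_pow_left₀ (by positivity) this 2
      linarith
    · exact mul_nonneg (sq_nonneg _) (hg.nonneg _ (hin z hz))
  · have hset : Ioi (1 / 2 : ℝ) ∩ Ioc 0 1 = Ioc (1 / 2) 1 := by
      ext x; simp only [mem_inter_iff, mem_Ioi, mem_Ioc]; constructor
      · rintro ⟨h1, h2, h3⟩; exact ⟨h1, h3⟩
      · rintro ⟨h1, h2⟩; exact ⟨h1, by linarith, h2⟩
    have himg : lsv a '' Ioc (1 / 2) 1 = Ioc 0 1 := by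
      ext y
      constructor
      · rintro ⟨x, hx, rfl⟩
        rw [lsv_right hx.1]
        exact ⟨by linarith [hx.1], by linarith [hx.2]⟩
      · intro hy
        have h1 : 1 / 2 < (y + 1) / 2 := by linarith [hy.1]
        exact ⟨(y + 1) / 2, ⟨h1, (hin y hy).2⟩, by rw [lsv_right h1]; ring⟩
    rw [densMeasure, restrict_withDensity measurableSet_Ioi,
      Measure.restrict_restrict measurableSet_Ioi, hset,
      map_withDensity_restrict (f' := fun _ => 2) (k := fun y => (y + 1) / 2) _
        measurableSet_Ioc (measurable_lsv a) (fun x hx => ?_) (fun x hx => two_pos) himg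
        (fun x hx => ?_)]
    · refine withDensity_congr_ae (ae_of_all _ fun y => ?_)
      simp only
      rw [ENNReal.ofReal_div_of_pos two_pos]
    · have h := (((hasDerivAt_id x).const_mul 2).sub_const 1).hasDerivWithinAt
        (s := Ioc (1 / 2) 1)
      exact (h.congr (fun y hy => lsv_right hy.1) (lsv_right hx.1)).congr_deriv (by simp)
    · rw [lsv_right hx.1]; ring

/-- The uniform measure on `[0,1]`. -/
def unif : Measure ℝ := volume.restrict (Icc 0 1)

instance : IsProbabilityMeasure unif := ⟨by simp [unif]⟩

lemma measurable_phiMap (p : ℝ) : Measurable (phiMap p) := by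
  unfold phiMap
  refine Measurable.ite measurableSet_Iio ?_ ?_ <;> fun_prop

lemma map_phi_left {p : ℝ} (hp : 0 < p) (hp1 : p < 1) :
    (unif.restrict (Iio p)).map (phiMap p) = ENNReal.ofReal p • unif := by
  have hset : Iio p ∩ Icc 0 1 = Ico 0 p := by
    ext x; simp only [mem_inter_iff, mem_Iio, mem_Icc, mem_Ico]; constructor
    · rintro ⟨h1, h2, h3⟩; exact ⟨h2, h1⟩
    · rintro ⟨h1, h2⟩; exact ⟨h2, h1, by linarith⟩
  have hphi : ∀ x ∈ Ico 0 p, phiMap p x = x / p := fun x hx => if_pos hx.2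
  have himg : phiMap p '' Ico 0 p = Ico 0 1 := by
    ext y
    constructor
    · rintro ⟨x, hx, rfl⟩
      rw [hphi x hx]
      exact ⟨div_nonneg hx.1 hp.le, (div_lt_one hp).2 hx.2⟩
    · intro hy
      have h : p * y ∈ Ico 0 p := ⟨mul_nonneg hp.le hy.1, by nlinarith [hy.2]⟩
      exact ⟨p * y, h, by rw [hphi _ h]; field_simp⟩
  have h := map_withDensity_restrict (f' := fun _ => p⁻¹) (k := fun y => p * y) 1
    measurableSet_Ico (measurable_phiMap p) (fun x hx => ?_) (fun x hx => inv_pos.2 hp) himg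
    (fun x hx => ?_)
  · rw [unif, Measure.restrict_restrict measurableSet_Iio, hset,
      ← withDensity_one (μ := volume.restrict (Ico 0 p)), h,
      ← Measure.restrict_congr_set (Ico_ae_eq_Icc (μ := volume) (a := (0 : ℝ)) (b := 1))]
    have : (fun _ : ℝ => (1 : ENNReal) / ENNReal.ofReal p⁻¹) = fun _ => ENNReal.ofReal p := by
      funext _
      rw [ENNReal.ofReal_inv_of_pos hp]; simp
    simp only [Pi.one_apply]
    rw [this, withDensity_const]
  · have h := ((hasDerivAt_id x).div_const p).hasDerivWithinAt (s := Ico 0 p)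
    exact (h.congr (fun y hy => hphi y hy) (hphi x hx)).congr_deriv (by simp)
  · rw [hphi x hx]; field_simp

lemma map_phi_right {p : ℝ} (hp : 0 < p) (hp1 : p < 1) :
    (unif.restrict (Ici p)).map (phiMap p) = ENNReal.ofReal (1 - p) • unif := by
  have hq : 0 < 1 - p := by linarith
  have hset : Ici p ∩ Icc 0 1 = Icc p 1 := by
    ext x; simp only [mem_inter_iff, mem_Ici, mem_Icc]; constructor
    · rintro ⟨h1, h2, h3⟩; exact ⟨h1, h3⟩
    · rintro ⟨h1, h2⟩; exact ⟨h1, by linarith, h2⟩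
  have hphi : ∀ x ∈ Icc p 1, phiMap p x = (x - p) / (1 - p) := fun x hx =>
    if_neg (not_lt.2 hx.1)
  have himg : phiMap p '' Icc p 1 = Icc 0 1 := by
    ext y
    constructor
    · rintro ⟨x, hx, rfl⟩
      rw [hphi x hx]
      exact ⟨div_nonneg (by linarith [hx.1]) hq.le, (div_le_one hq).2 (by linarith [hx.2])⟩
    · intro hy
      have h : p + (1 - p) * y ∈ Icc p 1 := ⟨by nlinarith [hy.1], by nlinarith [hy.2]⟩
      exact ⟨p + (1 - p) * y, h, by rw [hphi _ h]; field_simp; ring⟩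
  have h := map_withDensity_restrict (f' := fun _ => (1 - p)⁻¹) (k := fun y => p + (1 - p) * y) 1
    measurableSet_Icc (measurable_phiMap p) (fun x hx => ?_) (fun x hx => inv_pos.2 hq) himg
    (fun x hx => ?_)
  · rw [unif, Measure.restrict_restrict measurableSet_Ici, hset,
      ← withDensity_one (μ := volume.restrict (Icc p 1)), h]
    have : (fun _ : ℝ => (1 : ENNReal) / ENNReal.ofReal (1 - p)⁻¹) =
        fun _ => ENNReal.ofReal (1 - p) := by
      funext _
      rw [ENNReal.ofReal_inv_of_pos hq]; simp
    simp only [Pi.one_apply]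
    rw [this, withDensity_const]
  · have h := (((hasDerivAt_id x).sub_const p).div_const (1 - p)).hasDerivWithinAt
      (s := Icc p 1)
    exact (h.congr (fun y hy => hphi y hy) (hphi x hx)).congr_deriv (by simp)
  · rw [hphi x hx]; field_simp; ring

/-- Measures on `(0,1] × [0,1]` whose density depends only on the first coordinate, through a
function of the cone. -/
def IsConeMeasure (γ : Measure (ℝ × ℝ)) : Prop :=
  ∃ g, InCone g ∧ γ = (densMeasure g).prod unif

namespace IsConeMeasure

lemma smul {γ : Measure (ℝ × ℝ)} (h : IsConeMeasure γ) {c : ℝ} (hc : 0 ≤ c) :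
    IsConeMeasure (ENNReal.ofReal c • γ) := by
  obtain ⟨g, hg, rfl⟩ := h
  exact ⟨_, hg.const_mul hc, by rw [densMeasure_const_mul hc, Measure.prod_smul_left]⟩

lemma add {γ δ : Measure (ℝ × ℝ)} (h : IsConeMeasure γ) (h' : IsConeMeasure δ) :
    IsConeMeasure (γ + δ) := by
  obtain ⟨g, hg, rfl⟩ := h
  obtain ⟨g', hg', rfl⟩ := h'
  exact ⟨_, hg.add hg', by rw [densMeasure_add hg hg', Measure.add_prod]⟩

lemma zero : IsConeMeasure 0 := by
  refine ⟨_, InCone.one.const_mul le_rfl, ?_⟩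
  rw [densMeasure_const_mul le_rfl]
  simp

lemma sum {ι : Type*} (s : Finset ι) {γ : ι → Measure (ℝ × ℝ)}
    (h : ∀ i ∈ s, IsConeMeasure (γ i)) : IsConeMeasure (∑ i ∈ s, γ i) := by
  classical
  induction s using Finset.induction_on with
  | empty => simpa using zero
  | insert i s hi ih =>
    rw [Finset.sum_insert hi]
    exact (h i (Finset.mem_insert_self i s)).add
      (ih fun j hj => h j (Finset.mem_insert_of_mem hj))

end IsConeMeasure

/-- The branch of the skew product to which a point belongs. -/
def branch (p₁ : ℝ) (p : ℝ × ℝ) : Bool × Bool := (decide (p.1 ≤ 1 / 2), decide (p.2 < p₁))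

lemma measurable_branch (p₁ : ℝ) : Measurable (branch p₁) := by
  refine Measurable.prodMk ?_ ?_
  · refine measurable_to_bool ?_
    simpa [preimage] using measurableSet_le (measurable_fst (α := ℝ) (β := ℝ)) (measurable_const (a := (1 / 2 : ℝ)))
  · refine measurable_to_bool ?_
    simpa [preimage] using measurableSet_lt (measurable_snd (α := ℝ) (β := ℝ)) (measurable_const (a := p₁))

lemma measurable_skewLSV (α β p₁ : ℝ) : Measurable (skewLSV α β p₁) := by
  have h : skewLSV α β p₁ = fun p => if p.2 < p₁ then (lsv α p.1, phiMap p₁ p.2)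
      else (lsv β p.1, phiMap p₁ p.2) := by
    funext p
    unfold skewLSV alphaOf
    split_ifs <;> rfl
  rw [h]
  have hφ : Measurable fun p : ℝ × ℝ => phiMap p₁ p.2 :=
    (measurable_phiMap p₁).comp measurable_snd
  refine Measurable.ite (measurableSet_lt measurable_snd measurable_const) ?_ ?_
  · exact ((measurable_lsv α).comp measurable_fst).prodMk hφ
  · exact ((measurable_lsv β).comp measurable_fst).prodMk hφ

lemma map_restrict_prod {μ ν : Measure ℝ} [SFinite μ] [SFinite ν] {U V : Set ℝ}
    (hU : MeasurableSet U) (hV : MeasurableSet V) {F : ℝ × ℝ → ℝ × ℝ} {f g : ℝ → ℝ}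
    (hf : Measurable f) (hg : Measurable g) (h : EqOn F (Prod.map f g) (U ×ˢ V)) :
    ((μ.prod ν).restrict (U ×ˢ V)).map F = ((μ.restrict U).map f).prod ((ν.restrict V).map g) := by
  rw [Measure.map_congr ((ae_restrict_iff' (hU.prod hV)).2 (ae_of_all _ h)),
    ← Measure.prod_restrict, Measure.map_prod_map _ _ hf hg]

section SkewProduct

variable {α β p₁ : ℝ}

/-- Each branch of the skew product preserves cone measures. -/
lemma IsConeMeasure.map_branch (hα : 0 < α) (hα1 : α ≤ 1) (hβ : 0 < β) (hβ1 : β ≤ 1)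
    (hp : 0 < p₁) (hp1 : p₁ < 1) {γ : Measure (ℝ × ℝ)} (h : IsConeMeasure γ) (b : Bool × Bool) :
    IsConeMeasure ((γ.restrict (branch p₁ ⁻¹' {b})).map (skewLSV α β p₁)) := by
  obtain ⟨g, hg, rfl⟩ := h
  have hset : branch p₁ ⁻¹' {b} = (if b.1 then Iic (1 / 2) else Ioi (1 / 2)) ×ˢ
      (if b.2 then Iio p₁ else Ici p₁) := by
    ext ⟨x, w⟩
    obtain ⟨b1, b2⟩ := b
    cases b1 <;> cases b2 <;> simp [branch]
  have key : ∀ (a c : ℝ) (U V : Set ℝ), 0 ≤ c → MeasurableSet U → MeasurableSet V →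
      (∀ w ∈ V, alphaOf α β p₁ w = a) →
      (∃ h, InCone h ∧ ((densMeasure g).restrict U).map (lsv a) = densMeasure h) →
      (unif.restrict V).map (phiMap p₁) = ENNReal.ofReal c • unif →
      IsConeMeasure ((((densMeasure g).prod unif).restrict (U ×ˢ V)).map (skewLSV α β p₁)) := by
    rintro a c U V hc hU hV ha ⟨h, hh, he⟩ hφ
    rw [map_restrict_prod hU hV (measurable_lsv a) (measurable_phiMap p₁), he, hφ,
      Measure.prod_smul_right]
    · exact IsConeMeasure.smul ⟨h, hh, rfl⟩ hc
    · rintro ⟨x, w⟩ hx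
      simp [skewLSV, ha w hx.2]
  rw [hset]
  obtain ⟨b1, b2⟩ := b
  have hl : ∀ w ∈ Iio p₁, alphaOf α β p₁ w = α := fun w hw => if_pos hw
  have hr : ∀ w ∈ Ici p₁, alphaOf α β p₁ w = β := fun w hw => if_neg (not_lt.2 hw)
  cases b1 <;> cases b2
  · exact key β _ _ _ (by linarith) measurableSet_Ioi measurableSet_Ici hr
      (exists_map_right β hg) (map_phi_right hp hp1)
  · exact key α _ _ _ hp.le measurableSet_Ioi measurableSet_Iio hl
      (exists_map_right α hg) (map_phi_left hp hp1)
  · exact key β _ _ _ (by linarith) measurableSet_Iic measurableSet_Ici hr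
      (exists_map_left hβ hβ1 hg) (map_phi_right hp hp1)
  · exact key α _ _ _ hp.le measurableSet_Iic measurableSet_Iio hl
      (exists_map_left hα hα1 hg) (map_phi_left hp hp1)

lemma eq_sum_restrict_fiber {X ι : Type*} [MeasurableSpace X] [Fintype ι] [MeasurableSpace ι]
    [MeasurableSingletonClass ι] (μ : Measure X) {f : X → ι} (hf : Measurable f) :
    μ = ∑ i, μ.restrict (f ⁻¹' {i}) := by
  ext A hA
  have h := sum_measure_preimage_singleton (μ := μ.restrict A) (f := f) Finset.univ
    (fun i _ => hf (measurableSet_singleton i))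
  simp only [Finset.coe_univ, preimage_univ, Measure.restrict_apply_univ] at h
  rw [← h, Measure.finsetSum_apply]
  refine Finset.sum_congr rfl fun i _ => ?_
  rw [Measure.restrict_apply hA, Measure.restrict_apply (hf (measurableSet_singleton i)),
    inter_comm]

lemma map_eq_sum_branch (μ : Measure (ℝ × ℝ)) {F : ℝ × ℝ → ℝ × ℝ} (hF : Measurable F) :
    μ.map F = ∑ b, (μ.restrict (branch p₁ ⁻¹' {b})).map F := by
  conv_lhs => rw [eq_sum_restrict_fiber μ (measurable_branch p₁)]
  ext A hA
  simp only [Measure.map_apply hF hA, Measure.finsetSum_apply]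

lemma map_withDensity_comp {X Y : Type*} [MeasurableSpace X] [MeasurableSpace Y] (μ : Measure X)
    {f : X → Y} (hf : Measurable f) {w : Y → ENNReal} (hw : Measurable w) :
    (μ.withDensity (fun x => w (f x))).map f = (μ.map f).withDensity w := by
  ext A hA
  rw [Measure.map_apply hf hA, withDensity_apply _ (hf hA), withDensity_apply _ hA,
    setLIntegral_map hA hw hf]

/-- The skew product preserves cone measures. -/
lemma IsConeMeasure.map_skew (hα : 0 < α) (hα1 : α ≤ 1) (hβ : 0 < β) (hβ1 : β ≤ 1)
    (hp : 0 < p₁) (hp1 : p₁ < 1) {γ : Measure (ℝ × ℝ)} (h : IsConeMeasure γ) :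
    IsConeMeasure (γ.map (skewLSV α β p₁)) := by
  rw [map_eq_sum_branch (p₁ := p₁) γ (measurable_skewLSV α β p₁)]
  exact .sum _ fun b _ => h.map_branch hα hα1 hβ hβ1 hp hp1 b

lemma IsConeMeasure.map_iterate (hα : 0 < α) (hα1 : α ≤ 1) (hβ : 0 < β) (hβ1 : β ≤ 1)
    (hp : 0 < p₁) (hp1 : p₁ < 1) {γ : Measure (ℝ × ℝ)} (h : IsConeMeasure γ) (n : ℕ) :
    IsConeMeasure (γ.map (skewLSV α β p₁)^[n]) := by
  induction n with
  | zero => simpa using h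
  | succ n ih =>
    have hS := measurable_skewLSV α β p₁
    rw [Function.iterate_succ', ← Measure.map_map hS (hS.iterate n)]
    exact ih.map_skew hα hα1 hβ hβ1 hp hp1

/-- The first `n` branches visited by a point. -/
def itinerary (α β p₁ : ℝ) (n : ℕ) (p : ℝ × ℝ) : Fin n → Bool × Bool :=
  fun i => branch p₁ ((skewLSV α β p₁)^[i] p)

lemma measurable_itinerary (n : ℕ) : Measurable (itinerary α β p₁ n) :=
  measurable_pi_lambda _ fun i =>
    (measurable_branch p₁).comp ((measurable_skewLSV α β p₁).iterate i)

lemma itinerary_succ (n : ℕ) (p : ℝ × ℝ) :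
    itinerary α β p₁ (n + 1) p =
      Fin.cons (branch p₁ p) (itinerary α β p₁ n (skewLSV α β p₁ p)) := by
  funext i
  refine Fin.cases ?_ (fun j => ?_) i
  · simp [itinerary]
  · simp [itinerary]

/-- After `n` steps a density depending on the first `n` branches is sent into the cone. -/
lemma IsConeMeasure.map_withDensity_itinerary (hα : 0 < α) (hα1 : α ≤ 1) (hβ : 0 < β)
    (hβ1 : β ≤ 1) (hp : 0 < p₁) (hp1 : p₁ < 1) (n : ℕ) :
    ∀ {γ : Measure (ℝ × ℝ)}, IsConeMeasure γ → ∀ F : (Fin n → Bool × Bool) → ℝ, (∀ u, 0 ≤ F u) →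
      IsConeMeasure ((γ.withDensity
        (fun p => ENNReal.ofReal (F (itinerary α β p₁ n p)))).map (skewLSV α β p₁)^[n]) := by
  have hS := measurable_skewLSV α β p₁
  induction n with
  | zero =>
    intro γ h F hF
    have : (fun p => ENNReal.ofReal (F (itinerary α β p₁ 0 p))) =
        fun _ => ENNReal.ofReal (F Fin.elim0) := by
      funext p
      congr 2
      exact Subsingleton.elim _ _
    rw [this, withDensity_const]
    simpa using h.smul (hF _)
  | succ n ih =>
    intro γ h F hF
    rw [map_eq_sum_branch (p₁ := p₁) _ (hS.iterate _)]
    refine .sum _ fun b _ => ?_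
    have hb : MeasurableSet (branch p₁ ⁻¹' {b}) := measurable_branch p₁ (measurableSet_singleton b)
    have hw : Measurable (fun p => ENNReal.ofReal (F (Fin.cons b (itinerary α β p₁ n p)))) :=
      (measurable_of_finite (fun u : Fin n → Bool × Bool =>
        ENNReal.ofReal (F (Fin.cons b u)))).comp (measurable_itinerary n)
    have he : (γ.restrict (branch p₁ ⁻¹' {b})).withDensity
          (fun p => ENNReal.ofReal (F (itinerary α β p₁ (n + 1) p))) =
        (γ.restrict (branch p₁ ⁻¹' {b})).withDensity
          (fun p => ENNReal.ofReal (F (Fin.cons b (itinerary α β p₁ n (skewLSV α β p₁ p))))) := by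
      refine withDensity_congr_ae ((ae_restrict_iff' hb).2 (ae_of_all _ fun p hp => ?_))
      simp only
      rw [itinerary_succ, show branch p₁ p = b from hp]
    rw [restrict_withDensity hb, he, Function.iterate_succ, ← Measure.map_map (hS.iterate n) hS,
      map_withDensity_comp _ hS hw]
    exact ih (h.map_branch hα hα1 hβ hβ1 hp hp1 b) (fun u => F (Fin.cons b u)) fun u => hF _

/-- The unit square. -/
def unitSquare : Set (ℝ × ℝ) := Icc (0 : ℝ) 1 ×ˢ Icc (0 : ℝ) 1

lemma measurableSet_unitSquare : MeasurableSet unitSquare :=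
  measurableSet_Icc.prod measurableSet_Icc

lemma lsv_mem_Icc {a x : ℝ} (ha : 0 < a) (hx : x ∈ Icc (0 : ℝ) 1) : lsv a x ∈ Icc (0 : ℝ) 1 := by
  have hx0 := hx.1
  by_cases h : x ≤ 1 / 2
  · rcases hx0.eq_or_lt with h0 | h0
    · rw [← h0, lsv_left (by norm_num)]
      simp
    · exact Ioc_subset_Icc_self (image_lsv ha ▸ mem_image_of_mem _ ⟨h0, h⟩)
  · push Not at h
    rw [lsv_right h]
    exact ⟨by linarith, by linarith [hx.2]⟩

lemma phiMap_mem_Icc (hp : 0 < p₁) (hp1 : p₁ < 1) {x : ℝ} (hx : x ∈ Icc (0 : ℝ) 1) :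
    phiMap p₁ x ∈ Icc (0 : ℝ) 1 := by
  unfold phiMap
  have hx0 := hx.1
  have hx1 := hx.2
  split_ifs with h
  · exact ⟨by positivity, (div_le_one hp).2 h.le⟩
  · push Not at h
    exact ⟨div_nonneg (by linarith) (by linarith), (div_le_one (by linarith)).2 (by linarith)⟩

lemma skewLSV_mem (hα : 0 < α) (hβ : 0 < β) (hp : 0 < p₁) (hp1 : p₁ < 1) {p : ℝ × ℝ}
    (h : p ∈ unitSquare) : skewLSV α β p₁ p ∈ unitSquare := by
  refine ⟨lsv_mem_Icc ?_ h.1, phiMap_mem_Icc hp hp1 h.2⟩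
  unfold alphaOf
  split_ifs <;> assumption

lemma iterate_skewLSV_mem (hα : 0 < α) (hβ : 0 < β) (hp : 0 < p₁) (hp1 : p₁ < 1) {p : ℝ × ℝ}
    (h : p ∈ unitSquare) (n : ℕ) : (skewLSV α β p₁)^[n] p ∈ unitSquare := by
  induction n with
  | zero => exact h
  | succ n ih =>
    rw [Function.iterate_succ_apply']
    exact skewLSV_mem hα hβ hp hp1 ih

/-- Each branch of an LSV map expands distances, uniformly at every scale. -/
lemma lsv_expand {a d x y : ℝ} (ha : 0 < a) (ha1 : a ≤ 1) (hx : 0 ≤ x) (hy : y ≤ 1)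
    (hb : x ≤ 1 / 2 ↔ y ≤ 1 / 2) (hd : 0 ≤ d) (hxy : d ≤ y - x) :
    (1 + 2 * d) * (y - x) ≤ lsv a y - lsv a x := by
  by_cases h : y ≤ 1 / 2
  · rw [lsv_left h, lsv_left (hb.2 h)]
    have h1 := two_rpow_mul_mono ha hx (show x ≤ y by linarith)
    have h2 : 2 * y ≤ (2 : ℝ) ^ a * y ^ a := by
      rw [← Real.mul_rpow (by norm_num) (by linarith)]
      exact Real.self_le_rpow_of_le_one (by linarith) (by linarith) ha1
    have h3 := mul_le_mul_of_nonneg_left h1 hx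
    have h4 := mul_le_mul_of_nonneg_left (show 2 * d ≤ (2 : ℝ) ^ a * y ^ a by linarith)
      (show 0 ≤ y - x by linarith)
    linarith
  · have h' : ¬ x ≤ 1 / 2 := fun hx => h (hb.1 hx)
    push Not at h h'
    rw [lsv_right h, lsv_right h']
    nlinarith

lemma phiMap_expand (hp : 0 < p₁) (hp1 : p₁ < 1) {x y : ℝ} (hxy : x ≤ y)
    (hb : x < p₁ ↔ y < p₁) :
    (1 + min p₁ (1 - p₁)) * (y - x) ≤ phiMap p₁ y - phiMap p₁ x := by
  have hm1 := min_le_left p₁ (1 - p₁)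
  have hm2 := min_le_right p₁ (1 - p₁)
  unfold phiMap
  by_cases h : y < p₁
  · rw [if_pos h, if_pos (hb.2 h), ← sub_div, le_div_iff₀ hp]
    have : (1 + min p₁ (1 - p₁)) * p₁ ≤ 1 := by nlinarith
    nlinarith
  · rw [if_neg h, if_neg (fun hx => h (hb.1 hx)), ← sub_div, le_div_iff₀ (by linarith)]
    have : (1 + min p₁ (1 - p₁)) * (1 - p₁) ≤ 1 := by nlinarith
    nlinarith

lemma nonpos_of_pow_mul_le {κ d : ℝ} (hκ : 1 < κ) (h : ∀ n : ℕ, κ ^ n * d ≤ 1) : d ≤ 0 := by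
  by_contra! hd
  obtain ⟨n, hn⟩ := pow_unbounded_of_one_lt (1 / d) hκ
  rw [div_lt_iff₀ hd] at hn
  exact absurd (h n) (not_le.2 hn)

/-- The full sequence of branches visited by a point. -/
def coding (α β p₁ : ℝ) (p : ℝ × ℝ) : ℕ → Bool × Bool :=
  fun n => branch p₁ ((skewLSV α β p₁)^[n] p)

lemma branch_eq_iff {p q : ℝ × ℝ} : branch p₁ p = branch p₁ q ↔
    (p.1 ≤ 1 / 2 ↔ q.1 ≤ 1 / 2) ∧ (p.2 < p₁ ↔ q.2 < p₁) := by
  simp [branch]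

lemma alphaOf_congr {x y : ℝ} (h : x < p₁ ↔ y < p₁) : alphaOf α β p₁ x = alphaOf α β p₁ y := by
  simp only [alphaOf, h]

lemma le_of_coding_eq (hα : 0 < α) (hα1 : α ≤ 1) (hβ : 0 < β) (hβ1 : β ≤ 1) (hp : 0 < p₁)
    (hp1 : p₁ < 1) {p q : ℝ × ℝ} (hP : p ∈ unitSquare) (hQ : q ∈ unitSquare)
    (h : coding α β p₁ p = coding α β p₁ q) : q.1 ≤ p.1 ∧ q.2 ≤ p.2 := by
  set S := skewLSV α β p₁
  have hSp := iterate_skewLSV_mem hα hβ hp hp1 hP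
  have hSq := iterate_skewLSV_mem hα hβ hp hp1 hQ
  have hb := fun n => branch_eq_iff.1 (congrFun h n)
  have hpar : ∀ w, 0 < alphaOf α β p₁ w ∧ alphaOf α β p₁ w ≤ 1 := fun w => by
    unfold alphaOf
    split_ifs <;> constructor <;> assumption
  constructor
  · by_contra! hlt
    set d := q.1 - p.1 with hd
    have hd0 : 0 < d := sub_pos.2 hlt
    have key : ∀ n : ℕ, (1 + 2 * d) ^ n * d ≤ (S^[n] q).1 - (S^[n] p).1 := by
      intro n
      induction n with
      | zero => simp [hd]
      | succ n ih =>
        have hge : d ≤ (S^[n] q).1 - (S^[n] p).1 := by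
          refine le_trans ?_ ih
          exact le_mul_of_one_le_left hd0.le (one_le_pow₀ (by linarith))
        have hstep := lsv_expand (hpar (S^[n] q).2).1 (hpar (S^[n] q).2).2 (hSp n).1.1
          (hSq n).1.2 (hb n).1 hd0.le hge
        rw [Function.iterate_succ_apply', Function.iterate_succ_apply', pow_succ']
        have e : (S (S^[n] p)).1 = lsv (alphaOf α β p₁ (S^[n] q).2) (S^[n] p).1 := by
          rw [← alphaOf_congr (hb n).2]
          rfl
        rw [e]
        refine le_trans ?_ hstep
        rw [mul_assoc]
        exact mul_le_mul_of_nonneg_left ih (by linarith)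
    have := nonpos_of_pow_mul_le (κ := 1 + 2 * d) (d := d) (by linarith) fun n =>
      (key n).trans (by linarith [(hSp n).1.1, (hSq n).1.2])
    linarith
  · by_contra! hlt
    set κ := 1 + min p₁ (1 - p₁) with hκ
    have hκ1 : 1 < κ := by
      have : 0 < min p₁ (1 - p₁) := lt_min hp (by linarith)
      linarith
    have hd0 : 0 < q.2 - p.2 := sub_pos.2 hlt
    have key : ∀ n : ℕ, κ ^ n * (q.2 - p.2) ≤ (S^[n] q).2 - (S^[n] p).2 := by
      intro n
      induction n with
      | zero => simp
      | succ n ih =>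
        have hge : (S^[n] p).2 ≤ (S^[n] q).2 := by
          have : 0 ≤ κ ^ n * (q.2 - p.2) := by positivity
          linarith
        have hstep := phiMap_expand hp hp1 hge (hb n).2
        rw [Function.iterate_succ_apply', Function.iterate_succ_apply', pow_succ', mul_assoc]
        exact (mul_le_mul_of_nonneg_left ih (by linarith)).trans hstep
    have := nonpos_of_pow_mul_le hκ1 fun n =>
      (key n).trans (by linarith [(hSp n).2.1, (hSq n).2.2])
    linarith

lemma injOn_coding (hα : 0 < α) (hα1 : α ≤ 1) (hβ : 0 < β) (hβ1 : β ≤ 1) (hp : 0 < p₁)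
    (hp1 : p₁ < 1) : InjOn (coding α β p₁) unitSquare := fun _ hP _ hQ h =>
  have h1 := le_of_coding_eq hα hα1 hβ hβ1 hp hp1 hP hQ h
  have h2 := le_of_coding_eq hα hα1 hβ hβ1 hp hp1 hQ hP h.symm
  Prod.ext (le_antisymm h2.1 h1.1) (le_antisymm h2.2 h1.2)

lemma measurable_coding : Measurable (coding α β p₁) :=
  measurable_pi_lambda _ fun i =>
    (measurable_branch p₁).comp ((measurable_skewLSV α β p₁).iterate i)

/-- The filtration generated by the branches visited. -/
def branchFiltration (α β p₁ : ℝ) :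
    Filtration ℕ (inferInstance : MeasurableSpace (ℝ × ℝ)) where
  seq n := MeasurableSpace.comap (itinerary α β p₁ n) inferInstance
  mono' m n h := by
    have : itinerary α β p₁ m = (fun u i => u (Fin.castLE h i)) ∘ itinerary α β p₁ n := rfl
    simp only
    rw [this, ← MeasurableSpace.comap_comp]
    exact MeasurableSpace.comap_mono (measurable_of_finite _).comap_le
  le' n := (measurable_itinerary n).comap_le

lemma measurable_iSup_coding :
    Measurable[⨆ n, branchFiltration α β p₁ n] (coding α β p₁) := by
  refine @measurable_pi_lambda _ _ _ (⨆ n, branchFiltration α β p₁ n) _ _ fun i => ?_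
  have h : Measurable[branchFiltration α β p₁ (i + 1)] (itinerary α β p₁ (i + 1)) :=
    comap_measurable _
  have h' : Measurable[branchFiltration α β p₁ (i + 1)] fun p => coding α β p₁ p i :=
    (measurable_pi_apply (⟨i, Nat.lt_succ_self i⟩ : Fin (i + 1))).comp h
  exact h'.mono (le_iSup (fun n => branchFiltration α β p₁ n) (i + 1)) le_rfl

/-- Every Borel function agrees on the unit square with a function of the coding. -/
lemma exists_comp_coding_eq (hα : 0 < α) (hα1 : α ≤ 1) (hβ : 0 < β) (hβ1 : β ≤ 1) (hp : 0 < p₁)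
    (hp1 : p₁ < 1) {f : ℝ × ℝ → ℝ} (hf : Measurable f) :
    ∃ f' : (ℕ → Bool × Bool) → ℝ, Measurable f' ∧
      ∀ p ∈ unitSquare, f' (coding α β p₁ p) = f p := by
  have : StandardBorelSpace unitSquare := measurableSet_unitSquare.standardBorel
  have hemb : MeasurableEmbedding (fun p : unitSquare => coding α β p₁ p) :=
    (measurable_coding.comp measurable_subtype_coe).measurableEmbedding
      (injOn_iff_injective.1 (injOn_coding hα hα1 hβ hβ1 hp hp1))
  obtain ⟨f', hf', h⟩ := hemb.exists_measurable_extend (hf.comp measurable_subtype_coe)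
    fun _ => ⟨0⟩
  exact ⟨f', hf', fun p hP => congrFun h ⟨p, hP⟩⟩

/-- Lebesgue measure on the unit square, as a cone measure. -/
def squareMeasure : Measure (ℝ × ℝ) := (densMeasure fun _ => 1).prod unif

lemma squareMeasure_eq : squareMeasure = volume.restrict (Ioc (0 : ℝ) 1 ×ˢ Icc (0 : ℝ) 1) := by
  have : densMeasure (fun _ => 1) = volume.restrict (Ioc 0 1) := by
    simp only [densMeasure, ENNReal.ofReal_one]
    exact withDensity_one
  rw [squareMeasure, this, unif, Measure.prod_restrict]
  rfl

lemma isConeMeasure_squareMeasure : IsConeMeasure squareMeasure := ⟨_, InCone.one, rfl⟩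

instance : IsProbabilityMeasure squareMeasure := by
  refine ⟨?_⟩
  rw [squareMeasure_eq, Measure.restrict_apply_univ, Measure.volume_eq_prod, Measure.prod_prod]
  simp

lemma ae_mem_unitSquare : ∀ᵐ p ∂squareMeasure, p ∈ unitSquare := by
  rw [squareMeasure_eq]
  exact (ae_restrict_mem (measurableSet_Ioc.prod measurableSet_Icc)).mono fun p hp =>
    ⟨Ioc_subset_Icc_self hp.1, hp.2⟩

/-- Absolutely continuous finite measures are approximated, in total variation, by measures whose
density depends on finitely many branches. -/
lemma exists_itinerary_approx (hα : 0 < α) (hα1 : α ≤ 1) (hβ : 0 < β) (hβ1 : β ≤ 1) (hp : 0 < p₁)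
    (hp1 : p₁ < 1) {μ : Measure (ℝ × ℝ)} [IsFiniteMeasure μ] (hμ : μ ≪ squareMeasure)
    {ε : ENNReal} (hε : 0 < ε) :
    ∃ (n : ℕ) (F : (Fin n → Bool × Bool) → ℝ), (∀ u, 0 ≤ F u) ∧ ∀ A, MeasurableSet A →
      μ A ≤ squareMeasure.withDensity
        (fun p => ENNReal.ofReal (F (itinerary α β p₁ n p))) A + ε ∧
      squareMeasure.withDensity
        (fun p => ENNReal.ofReal (F (itinerary α β p₁ n p))) A ≤ μ A + ε := by
  set f : ℝ × ℝ → ℝ := fun p => (μ.rnDeriv squareMeasure p).toReal with hf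
  have hfm : Measurable f := (Measure.measurable_rnDeriv _ _).ennreal_toReal
  have hfint : Integrable f squareMeasure := Measure.integrable_toReal_rnDeriv
  obtain ⟨f', hf'm, hf'⟩ := exists_comp_coding_eq hα hα1 hβ hβ1 hp hp1 hfm
  have hae : (f' ∘ coding α β p₁) =ᵐ[squareMeasure] f :=
    ae_mem_unitSquare.mono fun p h => hf' p h
  have hlim := (hfint.congr hae.symm).tendsto_eLpNorm_condExp (ℱ := branchFiltration α β p₁)
    (hf'm.comp measurable_iSup_coding).stronglyMeasurable
  obtain ⟨n, hn⟩ := (hlim.eventually (gt_mem_nhds hε)).exists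
  obtain ⟨F, hFm, hF⟩ := (stronglyMeasurable_condExp (m := branchFiltration α β p₁ n)
    (μ := squareMeasure) (f := f' ∘ coding α β p₁)).exists_eq_measurable_comp
  have hμd : μ = squareMeasure.withDensity (fun p => ENNReal.ofReal (f p)) := by
    conv_lhs => rw [← Measure.withDensity_rnDeriv_eq _ _ hμ]
    refine withDensity_congr_ae ((Measure.rnDeriv_lt_top μ squareMeasure).mono fun p h => ?_)
    simp only [hf]
    rw [ENNReal.ofReal_toReal h.ne]
  refine ⟨n, fun u => max (F u) 0, fun u => le_max_right _ _, fun A hA => ?_⟩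
  set G : ℝ × ℝ → ℝ := fun p => F (itinerary α β p₁ n p) with hG
  have hGm : Measurable G := hFm.measurable.comp (measurable_itinerary n)
  have herr : ∫⁻ p, ‖G p - f p‖ₑ ∂squareMeasure ≤ ε := by
    refine le_trans (le_of_eq ?_) hn.le
    rw [eLpNorm_one_eq_lintegral_enorm, hF]
    refine lintegral_congr_ae (hae.mono fun p h => ?_)
    simp only [Pi.sub_apply, Function.comp_apply, hG] at h ⊢
    rw [h]
  have herrA : ∫⁻ p in A, ‖G p - f p‖ₑ ∂squareMeasure ≤ ε :=
    (setLIntegral_le_lintegral _ _).trans herr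
  have hfpos : ∀ p, 0 ≤ f p := fun p => ENNReal.toReal_nonneg
  have hem : Measurable fun p => ‖G p - f p‖ₑ := (hGm.sub hfm).enorm
  rw [hμd, withDensity_apply _ hA, withDensity_apply _ hA]
  constructor
  · refine le_trans ?_ (add_le_add le_rfl herrA)
    rw [← lintegral_add_right _ hem]
    refine lintegral_mono fun p => ?_
    simp only
    rw [← ofReal_norm, ← ENNReal.ofReal_add (le_max_right _ _) (norm_nonneg _)]
    refine ENNReal.ofReal_le_ofReal ?_
    have h1 := neg_abs_le (G p - f p)
    have h2 := le_max_left (G p) 0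
    rw [Real.norm_eq_abs]
    simp only [hG] at h1 h2 ⊢
    linarith
  · refine le_trans ?_ (add_le_add le_rfl herrA)
    rw [← lintegral_add_right _ hem]
    refine lintegral_mono fun p => ?_
    simp only
    rw [← ofReal_norm, ← ENNReal.ofReal_add (hfpos p) (norm_nonneg _)]
    refine ENNReal.ofReal_le_ofReal (max_le ?_ (add_nonneg (hfpos p) (norm_nonneg _)))
    have h1 := le_abs_self (G p - f p)
    rw [Real.norm_eq_abs]
    simp only [hG] at h1 ⊢
    linarith

section Coupling

variable {X : Type*} [MeasurableSpace X]

/-- The largest excess of mass that `a` gives to a set, compared with `b`. -/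
def massExcess (a b : Measure X) : ENNReal := ⨆ A : {A : Set X // MeasurableSet A}, a A - b A

lemma le_add_massExcess (a b : Measure X) {A : Set X} (hA : MeasurableSet A) :
    a A ≤ massExcess a b + b A :=
  tsub_le_iff_right.1 (le_iSup (fun A : {A : Set X // MeasurableSet A} => a A - b A) ⟨A, hA⟩)

lemma massExcess_map_le (a b : Measure X) {S : X → X} (hS : Measurable S) :
    massExcess (a.map S) (b.map S) ≤ massExcess a b := by
  refine iSup_le fun A => ?_
  rw [Measure.map_apply hS A.2, Measure.map_apply hS A.2]
  exact tsub_le_iff_right.2 (le_add_massExcess a b (hS A.2))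

lemma exists_excess_part (a b : Measure X) [IsFiniteMeasure a] [IsFiniteMeasure b] :
    ∃ d : Measure X, d ≤ a ∧ a ≤ b + d ∧ d univ = massExcess a b := by
  obtain ⟨H, hH⟩ := exists_isHahnDecomposition b a
  have hHm := hH.measurableSet
  have hd : a.restrict H - b.restrict H + b.restrict H = a.restrict H :=
    Measure.sub_add_cancel_of_le hH.le_on
  have hle : a ≤ b + (a.restrict H - b.restrict H) := by
    calc a = a.restrict H - b.restrict H + b.restrict H + a.restrict Hᶜ := by
          rw [hd, Measure.restrict_add_restrict_compl hHm]
      _ ≤ a.restrict H - b.restrict H + b.restrict H + b.restrict Hᶜ :=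
          add_le_add le_rfl hH.ge_on_compl
      _ = b + (a.restrict H - b.restrict H) := by
          rw [add_assoc, Measure.restrict_add_restrict_compl hHm, add_comm]
  refine ⟨a.restrict H - b.restrict H, Measure.sub_le.trans Measure.restrict_le_self, hle, ?_⟩
  apply le_antisymm
  · have h1 : (a.restrict H - b.restrict H) univ = a H - b H := by
      rw [Measure.sub_apply MeasurableSet.univ hH.le_on, Measure.restrict_apply_univ,
        Measure.restrict_apply_univ]
    rw [h1]
    exact le_iSup (fun A : {A : Set X // MeasurableSet A} => a A - b A) ⟨H, hHm⟩
  · refine iSup_le fun A => tsub_le_iff_right.2 ?_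
    refine (hle A).trans ?_
    rw [Measure.add_apply, add_comm]
    exact add_le_add (measure_mono (subset_univ _)) le_rfl

variable {S : X → X} {ν m : Measure X}

lemma map_iterate_le (hS : Measurable S) (hν : ν.map S = ν) {μ : Measure X} (hμ : μ ≤ ν) (n : ℕ) :
    μ.map S^[n] ≤ ν := by
  induction n with
  | zero => simpa using hμ
  | succ n ih =>
    rw [Function.iterate_succ', ← Measure.map_map hS (hS.iterate n)]
    exact (Measure.map_mono ih hS).trans hν.le

lemma massExcess_contract [IsFiniteMeasure ν] [IsProbabilityMeasure m] (hS : Measurable S)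
    {a b : Measure X} (ha : a ≤ ν) (hb : b ≤ ν) (hab : a univ = b univ) {c ε : ENNReal}
    (hc : c ≠ ⊤)
    (H : ∀ μ ≤ ν, massExcess a b ≤ μ univ → ∃ N, ∀ n ≥ N, ∀ A, MeasurableSet A →
      c * m A ≤ μ.map S^[n] A + ε) :
    ∃ k, massExcess (a.map S^[k]) (b.map S^[k]) ≤ massExcess a b + (ε + ε) - c := by
  have : IsFiniteMeasure a := isFiniteMeasure_of_le ν ha
  have : IsFiniteMeasure b := isFiniteMeasure_of_le ν hb
  obtain ⟨d, hda, had, hd⟩ := exists_excess_part a b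
  have : IsFiniteMeasure d := isFiniteMeasure_of_le a hda
  have hκ : a - d + d = a := Measure.sub_add_cancel_of_le hda
  have hκb : a - d ≤ b := Measure.sub_le_of_le_add had
  have hσ : b - (a - d) + (a - d) = b := Measure.sub_add_cancel_of_le hκb
  set κ := a - d
  set σ := b - κ
  have hσd : σ univ = massExcess a b := by
    have h1 : κ univ + d univ = σ univ + κ univ := by
      rw [← Measure.add_apply, ← Measure.add_apply, hκ, hσ, hab]
    rw [← hd]
    rw [add_comm] at h1
    exact ((ENNReal.add_left_inj (measure_ne_top κ univ)).1 h1).symm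
  obtain ⟨N₁, hN₁⟩ := H d (hda.trans ha) hd.ge
  obtain ⟨N₂, hN₂⟩ := H σ (Measure.sub_le.trans hb) hσd.ge
  refine ⟨max N₁ N₂, iSup_le fun ⟨A, hA⟩ => tsub_le_iff_right.2 ?_⟩
  set T := S^[max N₁ N₂]
  have hT : Measurable T := hS.iterate _
  have h1 := hN₁ _ (le_max_left N₁ N₂) Aᶜ hA.compl
  have h2 := hN₂ _ (le_max_right N₁ N₂) A hA
  have hmass : d.map T A + d.map T Aᶜ = massExcess a b := by
    rw [measure_add_measure_compl hA, Measure.map_apply hT MeasurableSet.univ, preimage_univ, hd]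
  have hm : c * m A + c * m Aᶜ = c := by
    rw [← mul_add, measure_add_measure_compl hA, measure_univ, mul_one]
  have ha' : a.map T A = κ.map T A + d.map T A := by
    rw [← Measure.add_apply, ← Measure.map_add _ _ hT, hκ]
  have hb' : b.map T A = σ.map T A + κ.map T A := by
    rw [← Measure.add_apply, ← Measure.map_add _ _ hT, hσ]
  have key : a.map T A + c ≤ b.map T A + (massExcess a b + (ε + ε)) := by
    calc a.map T A + c = κ.map T A + d.map T A + (c * m A + c * m Aᶜ) := by rw [ha', hm]
      _ ≤ κ.map T A + d.map T A + ((σ.map T A + ε) + (d.map T Aᶜ + ε)) := by gcongr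
      _ = b.map T A + (massExcess a b + (ε + ε)) := by rw [hb', ← hmass]; ring
  have := ENNReal.le_sub_of_add_le_right hc key
  rw [add_comm (_ - c)]
  exact this.trans add_tsub_le_assoc

/-- If all orbits of measures of a given mass dominated by `ν` asymptotically dominate a fixed
multiple of `m`, then any two measures of equal mass dominated by `ν` merge. -/
lemma tendsto_massExcess [IsFiniteMeasure ν] [IsProbabilityMeasure m] (hS : Measurable S)
    (hν : ν.map S = ν)
    (H : ∀ η : ENNReal, 0 < η → ∃ c : ENNReal, 0 < c ∧ c ≠ ⊤ ∧ ∀ μ ≤ ν, η ≤ μ univ →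
      ∀ ε : ENNReal, 0 < ε → ∃ N, ∀ n ≥ N, ∀ A, MeasurableSet A → c * m A ≤ μ.map S^[n] A + ε)
    {a b : Measure X} (ha : a ≤ ν) (hb : b ≤ ν) (hab : a univ = b univ) :
    Tendsto (fun n => massExcess (a.map S^[n]) (b.map S^[n])) atTop (𝓝 0) := by
  have hmm : ∀ (μ : Measure X) (n k : ℕ), μ.map S^[n + k] = (μ.map S^[n]).map S^[k] :=
    fun μ n k => by
      rw [Measure.map_map (hS.iterate k) (hS.iterate n), ← Function.iterate_add, add_comm]
  have hanti : Antitone fun n => massExcess (a.map S^[n]) (b.map S^[n]) :=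
    antitone_nat_of_succ_le fun n => by
      rw [hmm a n 1, hmm b n 1]
      exact massExcess_map_le _ _ (hS.iterate 1)
  have hlim := tendsto_atTop_iInf hanti
  suffices h0 : ⨅ n, massExcess (a.map S^[n]) (b.map S^[n]) = 0 by rwa [h0] at hlim
  set l := ⨅ n, massExcess (a.map S^[n]) (b.map S^[n]) with hl
  by_contra hne
  have hpos : 0 < l := pos_iff_ne_zero.2 hne
  have hle : ∀ n, l ≤ massExcess (a.map S^[n]) (b.map S^[n]) := fun n => iInf_le _ n
  have hltop : l ≠ ⊤ := by
    refine ne_top_of_le_ne_top ?_ (hle 0)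
    refine ne_top_of_le_ne_top (measure_ne_top ν univ) (iSup_le fun A => tsub_le_self.trans ?_)
    exact (map_iterate_le hS hν ha 0 _).trans (measure_mono (subset_univ _))
  obtain ⟨c, hc, hctop, Hc⟩ := H l hpos
  have hc2 : 0 < c / 2 := ENNReal.half_pos hc.ne'
  have hc4 : 0 < c / 2 / 2 := ENNReal.half_pos hc2.ne'
  obtain ⟨n, hn⟩ := iInf_lt_iff.1 (show l < l + c / 2 from ENNReal.lt_add_right hltop hc2.ne')
  have hmass : (a.map S^[n]) univ = (b.map S^[n]) univ := by
    rw [Measure.map_apply (hS.iterate n) MeasurableSet.univ,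
      Measure.map_apply (hS.iterate n) MeasurableSet.univ]
    exact hab
  obtain ⟨k, hk⟩ := massExcess_contract (m := m) hS (map_iterate_le hS hν ha n)
    (map_iterate_le hS hν hb n) hmass hctop
    fun μ hμ hm => Hc μ hμ ((hle n).trans hm) (c / 2 / 2) hc4
  rw [← hmm, ← hmm, ENNReal.add_halves] at hk
  have h1 := (hle (n + k)).trans hk
  have h2 := tsub_pos_iff_lt.1 (hpos.trans_le h1)
  have h3 : l + c ≤ massExcess (a.map S^[n]) (b.map S^[n]) + c / 2 :=
    (add_le_add h1 le_rfl).trans_eq (tsub_add_cancel_of_le h2.le)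
  have h4 : massExcess (a.map S^[n]) (b.map S^[n]) + c / 2 < l + c / 2 + c / 2 :=
    ENNReal.add_lt_add_right (ne_top_of_le_ne_top hctop ENNReal.half_le_self) hn
  rw [add_assoc, ENNReal.add_halves] at h4
  exact absurd h3 (not_le.2 h4)

end Coupling

/-- A cone measure with mass away from `x = 0` dominates a multiple of Lebesgue measure. -/
lemma IsConeMeasure.lower_bound {γ : Measure (ℝ × ℝ)} (h : IsConeMeasure γ) {δ c : ℝ} (hδ : 0 < δ)
    (hc : 0 < c) (hγ : ENNReal.ofReal c ≤ γ (Ici δ ×ˢ univ)) (A : Set (ℝ × ℝ)) :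
    ENNReal.ofReal (δ ^ 2 * c) * squareMeasure A ≤ γ A := by
  obtain ⟨g, hg, rfl⟩ := h
  have h1 : (1 : ℝ) ∈ Ioc (0 : ℝ) 1 := by norm_num
  have hup : ∀ x ∈ Ici δ ∩ Ioc (0 : ℝ) 1, g x ≤ g 1 / δ ^ 2 := by
    rintro x ⟨hx, hx'⟩
    have hm := hg.mono hx' h1 hx'.2
    simp only [one_pow, one_mul] at hm
    rw [le_div_iff₀ (by positivity)]
    have := pow_le_pow_left₀ hδ.le hx 2
    have := mul_le_mul_of_nonneg_right this (hg.nonneg x hx')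
    linarith
  have hle : ENNReal.ofReal c ≤ ENNReal.ofReal (g 1 / δ ^ 2) := by
    refine hγ.trans ?_
    rw [Measure.prod_prod, measure_univ, mul_one, densMeasure, withDensity_apply _ measurableSet_Ici,
      Measure.restrict_restrict measurableSet_Ici]
    refine (setLIntegral_mono' (measurableSet_Ici.inter measurableSet_Ioc) fun x hx =>
      ENNReal.ofReal_le_ofReal (hup x hx)).trans ?_
    rw [setLIntegral_const]
    refine mul_le_of_le_one_right' ?_
    refine (measure_mono inter_subset_right).trans ?_
    simp
  have hg1 : δ ^ 2 * c ≤ g 1 := by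
    have hg0 : 0 ≤ g 1 / δ ^ 2 := div_nonneg (hg.nonneg 1 h1) (by positivity)
    rw [ENNReal.ofReal_le_ofReal_iff hg0, le_div_iff₀ (by positivity)] at hle
    linarith
  rw [← smul_eq_mul, ← Measure.smul_apply, squareMeasure, ← Measure.prod_smul_left,
    ← densMeasure_const_mul (by positivity)]
  refine Measure.prod_mono (withDensity_mono ?_) le_rfl A
  refine (ae_restrict_iff' measurableSet_Ioc).2 (ae_of_all _ fun x hx => ?_)
  refine ENNReal.ofReal_le_ofReal ?_
  rw [mul_one]
  exact hg1.trans (hg.anti hx h1 hx.2)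

lemma absolutelyContinuous_squareMeasure {ν : Measure (ℝ × ℝ)}
    (hac : ν ≪ (volume : Measure (ℝ × ℝ)))
    (hsupp : ν ((Icc (0 : ℝ) 1 ×ˢ Icc (0 : ℝ) 1)ᶜ) = 0) : ν ≪ squareMeasure := by
  have hline : ν (({0} : Set ℝ) ×ˢ univ) = 0 := by
    apply hac
    rw [Measure.volume_eq_prod, Measure.prod_prod]
    simp
  refine Measure.AbsolutelyContinuous.mk fun A hA h => ?_
  rw [squareMeasure_eq, Measure.restrict_apply hA] at h
  refine measure_mono_null (t := (A ∩ Ioc (0 : ℝ) 1 ×ˢ Icc (0 : ℝ) 1) ∪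
    ((Icc (0 : ℝ) 1 ×ˢ Icc (0 : ℝ) 1)ᶜ ∪ ({0} : Set ℝ) ×ˢ univ)) ?_
    (measure_union_null (hac h) (measure_union_null hsupp hline))
  rintro ⟨x, w⟩ hx
  by_cases hQ : (x, w) ∈ Icc (0 : ℝ) 1 ×ˢ Icc (0 : ℝ) 1
  · rcases hQ.1.1.eq_or_lt with h0 | h0
    · exact Or.inr (Or.inr ⟨h0.symm, mem_univ _⟩)
    · exact Or.inl ⟨hx, ⟨h0, hQ.1.2⟩, hQ.2⟩
  · exact Or.inr (Or.inl hQ)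

/-- Measures dominated by `ν` do not concentrate near the neutral fixed point. -/
lemma exists_small_strip {ν : Measure (ℝ × ℝ)} [IsFiniteMeasure ν] (hν : ν ≪ squareMeasure)
    {ε : ENNReal} (hε : 0 < ε) : ∃ δ : ℝ, 0 < δ ∧ ν (Ici δ ×ˢ univ)ᶜ < ε := by
  set s : ℕ → Set (ℝ × ℝ) := fun n => (Ici (1 / ((n : ℝ) + 1)) ×ˢ univ)ᶜ with hs
  have hm : ∀ n, MeasurableSet (s n) := fun n =>
    (measurableSet_Ici.prod MeasurableSet.univ).compl
  have hanti : Antitone s := by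
    intro n k h
    refine compl_subset_compl.2 (prod_mono (Ici_subset_Ici.2 ?_) le_rfl)
    exact Nat.one_div_le_one_div h
  have hnull : ν (⋂ n, s n) = 0 := by
    refine hν ?_
    rw [squareMeasure_eq, Measure.restrict_apply (MeasurableSet.iInter hm)]
    convert! measure_empty (μ := (volume : Measure (ℝ × ℝ)))
    refine eq_empty_of_forall_notMem ?_
    rintro ⟨x, w⟩ ⟨hx, hx', -⟩
    obtain ⟨n, hn⟩ := exists_nat_one_div_lt hx'.1
    exact mem_iInter.1 hx n ⟨hn.le, mem_univ _⟩
  have hlim := tendsto_measure_iInter_atTop (μ := ν) (fun n => (hm n).nullMeasurableSet) hanti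
    ⟨0, measure_ne_top _ _⟩
  rw [hnull] at hlim
  obtain ⟨n, hn⟩ := (hlim.eventually (gt_mem_nhds hε)).exists
  exact ⟨1 / ((n : ℝ) + 1), by positivity, hn⟩

/-- Orbits of measures dominated by `ν` asymptotically dominate Lebesgue measure. -/
lemma exists_uniform_lower_bound (hα : 0 < α) (hα1 : α ≤ 1) (hβ : 0 < β) (hβ1 : β ≤ 1)
    (hp : 0 < p₁) (hp1 : p₁ < 1) {ν : Measure (ℝ × ℝ)} [IsFiniteMeasure ν]
    (hν : ν ≪ squareMeasure) (hinv : ν.map (skewLSV α β p₁) = ν) {η : ENNReal} (hη : 0 < η) :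
    ∃ c : ENNReal, 0 < c ∧ c ≠ ⊤ ∧ ∀ μ ≤ ν, η ≤ μ univ → ∀ ε : ENNReal, 0 < ε →
      ∃ N, ∀ n ≥ N, ∀ A, MeasurableSet A →
        c * squareMeasure A ≤ μ.map (skewLSV α β p₁)^[n] A + ε := by
  set S := skewLSV α β p₁
  have hS : Measurable S := measurable_skewLSV α β p₁
  obtain ⟨r, hr, hrη⟩ : ∃ r : ℝ, 0 < r ∧ ENNReal.ofReal (r + r + r) ≤ η := by
    obtain ⟨q, hq, hqη⟩ := ENNReal.lt_iff_exists_nnreal_btwn.1 hη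
    refine ⟨q / 3, by have : 0 < q := by exact_mod_cast hq
                      positivity, ?_⟩
    rw [show (q / 3 + q / 3 + q / 3 : ℝ) = q by ring, ENNReal.ofReal_coe_nnreal]
    exact hqη.le
  have hr' : 0 < ENNReal.ofReal r := ENNReal.ofReal_pos.2 hr
  obtain ⟨δ, hδ, hδν⟩ := exists_small_strip hν hr'
  refine ⟨ENNReal.ofReal (δ ^ 2 * r), ENNReal.ofReal_pos.2 (by positivity), ENNReal.ofReal_ne_top,
    fun μ hμ hμη ε hε => ?_⟩
  have : IsFiniteMeasure μ := isFiniteMeasure_of_le ν hμ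
  obtain ⟨N, F, hF, happ⟩ := exists_itinerary_approx hα hα1 hβ hβ1 hp hp1
    (hμ.absolutelyContinuous.trans hν) (lt_min hε hr')
  refine ⟨N, fun n hn A hA => ?_⟩
  set μ' := squareMeasure.withDensity fun p => ENNReal.ofReal (F (itinerary α β p₁ N p))
  have hT : Measurable S^[n] := hS.iterate n
  have hcone : IsConeMeasure (μ'.map S^[n]) := by
    obtain ⟨k, rfl⟩ := Nat.exists_eq_add_of_le' hn
    rw [Function.iterate_add, ← Measure.map_map (hS.iterate k) (hS.iterate N)]
    exact (isConeMeasure_squareMeasure.map_withDensity_itinerary hα hα1 hβ hβ1 hp hp1 N F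
      hF).map_iterate hα hα1 hβ hβ1 hp hp1 k
  have hE : MeasurableSet (Ici δ ×ˢ univ : Set (ℝ × ℝ)) := measurableSet_Ici.prod MeasurableSet.univ
  have hmass : ENNReal.ofReal r ≤ μ'.map S^[n] (Ici δ ×ˢ univ) := by
    have h1 : μ.map S^[n] (Ici δ ×ˢ univ) ≤ μ'.map S^[n] (Ici δ ×ˢ univ) + ENNReal.ofReal r := by
      rw [Measure.map_apply hT hE, Measure.map_apply hT hE]
      exact (happ _ (hT hE)).1.trans (add_le_add le_rfl (min_le_right _ _))
    have h2 : μ.map S^[n] (Ici δ ×ˢ univ)ᶜ ≤ ENNReal.ofReal r :=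
      (map_iterate_le hS hinv hμ n _).trans hδν.le
    have h3 : μ univ = μ.map S^[n] (Ici δ ×ˢ univ) + μ.map S^[n] (Ici δ ×ˢ univ)ᶜ := by
      rw [measure_add_measure_compl hE, Measure.map_apply hT MeasurableSet.univ, preimage_univ]
    have h4 : ENNReal.ofReal r + ENNReal.ofReal r + ENNReal.ofReal r ≤
        μ'.map S^[n] (Ici δ ×ˢ univ) + ENNReal.ofReal r + ENNReal.ofReal r := by
      rw [← ENNReal.ofReal_add hr.le hr.le, ← ENNReal.ofReal_add (by positivity) hr.le]
      exact (hrη.trans (hμη.trans h3.le)).trans (add_le_add h1 h2)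
    exact (ENNReal.add_le_add_iff_right ENNReal.ofReal_ne_top).1
      ((ENNReal.add_le_add_iff_right ENNReal.ofReal_ne_top).1 h4)
  refine (hcone.lower_bound hδ hr hmass A).trans ?_
  rw [Measure.map_apply hT hA, Measure.map_apply hT hA]
  exact (happ _ (hT hA)).2.trans (add_le_add le_rfl (min_le_left _ _))

end SkewProduct

/-- Theorem 1.2 (2): the system `(S,ν)` is mixing. -/
theorem skew_mixing (α β p₁ : ℝ) (hα : 0 < α) (hαβ : α < β) (hβ : β < 1)
    (hp₁ : 0 < p₁) (hp₁' : p₁ < 1)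
    (ν : Measure (ℝ × ℝ)) (hprob : IsProbabilityMeasure ν)
    (hac : ν ≪ (volume : Measure (ℝ × ℝ)))
    (hsupp : ν ((Icc (0 : ℝ) 1 ×ˢ Icc (0 : ℝ) 1)ᶜ) = 0)
    (hinv : ∀ A : Set (ℝ × ℝ), MeasurableSet A → ν (skewLSV α β p₁ ⁻¹' A) = ν A) :
    ∀ A B : Set (ℝ × ℝ), MeasurableSet A → MeasurableSet B →
      Tendsto (fun n : ℕ => ν (((skewLSV α β p₁)^[n] ⁻¹' A) ∩ B)) atTop
        (𝓝 (ν A * ν B)) := by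
  intro A B hA hB
  have hS : Measurable (skewLSV α β p₁) := measurable_skewLSV α β p₁
  have hν : ν.map (skewLSV α β p₁) = ν := by
    ext E hE
    rw [Measure.map_apply hS hE, hinv E hE]
  have hνm := absolutelyContinuous_squareMeasure hac hsupp
  have H := fun (η : ENNReal) (hη : 0 < η) => exists_uniform_lower_bound hα (hαβ.trans hβ).le
    (hα.trans hαβ) hβ.le hp₁ hp₁' hνm hν hη
  set S := skewLSV α β p₁
  have hνn : ∀ n, ν (S^[n] ⁻¹' A) = ν A := fun n =>
    ((MeasurePreserving.mk hS hν).iterate n).measure_preimage hA.nullMeasurableSet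
  have ha : ν.restrict B ≤ ν := Measure.restrict_le_self
  have hb : ν B • ν ≤ ν := Measure.le_iff.2 fun E _ => by
    rw [Measure.smul_apply, smul_eq_mul]
    exact mul_le_of_le_one_left' prob_le_one
  have hab : ν.restrict B univ = (ν B • ν) univ := by simp
  have h1 := tendsto_massExcess hS hν H ha hb hab
  have h2 := tendsto_massExcess hS hν H hb ha hab.symm
  have eA : ∀ n, (ν.restrict B).map S^[n] A = ν (S^[n] ⁻¹' A ∩ B) := fun n => by
    rw [Measure.map_apply (hS.iterate n) hA, Measure.restrict_apply (hS.iterate n hA)]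
  have eB : ∀ n, (ν B • ν).map S^[n] A = ν A * ν B := fun n => by
    rw [Measure.map_apply (hS.iterate n) hA, Measure.smul_apply, hνn, smul_eq_mul, mul_comm]
  have l1 := ENNReal.Tendsto.sub (tendsto_const_nhds (x := ν A * ν B)) h2
    (Or.inl (ENNReal.mul_ne_top (measure_ne_top _ _) (measure_ne_top _ _)))
  have l2 := h1.add_const (ν A * ν B)
  rw [tsub_zero] at l1
  rw [zero_add] at l2
  refine tendsto_of_tendsto_of_tendsto_of_le_of_le l1 l2 (fun n => ?_) fun n => ?_
  · have := le_add_massExcess ((ν B • ν).map S^[n]) ((ν.restrict B).map S^[n]) hA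
    rw [eA, eB] at this
    exact tsub_le_iff_left.2 this
  · have := le_add_massExcess ((ν.restrict B).map S^[n]) ((ν B • ν).map S^[n]) hA
    rwa [eA, eB] at this
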